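/- Let E ⊆ K be finite fields of odd characteristic with [K:E] = k. Let σ_K be a ring automorphism of K mapping E onto itself, let σ_E be the induced automorphism of E, and assume: σ_E ∘ σ_E = id; N_{K/E}(σ_K(x)) = σ_E(N_{K/E}(x)) for all x ∈ K; and Tr_{K/E}(σ_K(x)) = σ_E(Tr_{K/E}(x)) for all x ∈ K. Let ψ be a nontrivial additive character of E with ψ ∘ σ_E = ψ, and set ψ_K := ψ ∘ Tr_{K/E}. Let α be a multiplicative character of K and χ a multiplicative character of E with χ(y·σ_E(y)) = 1 for all y ∈ Eˣ. Set S := ∑_{x ∈ Kˣ, x ≠ −1} α(x) · χ(N_{K/E}(1 + x)) · χ(N_{K/E}(1 + σ_K(x)⁻¹)). Then: (1) if α(x) = χ(N_{K/E}(x))⁻¹ for all x ∈ Kˣ, then S = |K| − 2; (2) otherwise, S = −|K|^{−1} · (∑_{x ∈ Kˣ} α(x)⁻¹ χ(N_{K/E}(x))⁻¹ ψ_K(x)) · (∑_{x ∈ Kˣ} α(σ_K(x)) χ(N_{K/E}(x))⁻¹ ψ_K(x)). -/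

import Mathlib

namespace MulChar

/-- The pullback of a multiplicative character along the norm of a field extension. -/
noncomputable def compNorm {E : Type*} (K : Type*) [Field E] [Field K] [Algebra E K]
    [FiniteDimensional E K] {R : Type*} [CommMonoidWithZero R] (χ : MulChar E R) :
    MulChar K R where
  toMonoidHom := χ.toMonoidHom.comp (Algebra.norm E)
  map_nonunit' a ha := by
    have h : a = 0 := by simpa using ha
    subst h
    simp

@[simp]
theorem compNorm_apply {E K : Type*} [Field E] [Field K] [Algebra E K]
    [FiniteDimensional E K] {R : Type*} [CommMonoidWithZero R] (χ : MulChar E R) (x : K) :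
    χ.compNorm K x = χ (Algebra.norm E x) :=
  rfl

theorem apply_ne_zero {F R : Type*} [Field F] [CommMonoidWithZero R] [Nontrivial R]
    (χ : MulChar F R) {x : F} (hx : x ≠ 0) : χ x ≠ 0 :=
  ((isUnit_iff_ne_zero.mpr hx).map χ).ne_zero

theorem sum_units_eq_zero_of_ne_one {F R : Type*} [Field F] [Fintype F] [DecidableEq F]
    [CommRing R] [IsDomain R] {χ : MulChar F R} (hχ : χ ≠ 1) : ∑ x : Fˣ, χ (x : F) = 0 := by
  rw [← sum_eq_zero_of_ne_one hχ]
  refine Fintype.sum_of_injective _ Units.val_injective _ _ (fun x hx => ?_) fun _ => rfl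
  exact χ.map_nonunit fun ⟨u, hu⟩ => hx ⟨u, hu⟩

theorem sum_units_ne_neg_one {F R : Type*} [Field F] [Fintype F] [DecidableEq F]
    [CommRing R] (χ : MulChar F R) :
    ∑ x ∈ Finset.univ.filter (fun x : Fˣ => (x : F) ≠ -1), χ (x : F) =
      ∑ x : Fˣ, χ (x : F) - χ (-1) := by
  have h : Finset.univ.filter (fun x : Fˣ => (x : F) ≠ -1) = Finset.univ.erase (-1) := by
    ext x
    simp only [Finset.mem_filter, Finset.mem_univ, true_and, Finset.mem_erase, and_true,
      ne_eq, Units.ext_iff, Units.val_neg, Units.val_one]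
  rw [h, Finset.sum_erase_eq_sub (Finset.mem_univ _)]
  simp

theorem apply_one_add_mul_inv {F R : Type*} [Field F] [Field R] (χ : MulChar F R)
    {x : F} (hx : x ≠ 0) (hx' : x ≠ -1) : χ (1 + x) * (χ (1 + x⁻¹))⁻¹ = χ x := by
  have h : 1 + x⁻¹ ≠ 0 := by
    intro h
    refine hx' ?_
    rw [← inv_inv x, eq_neg_of_add_eq_zero_right h, inv_neg, inv_one]
  rw [show 1 + x = x * (1 + x⁻¹) by field_simp; ring, map_mul,
    mul_inv_cancel_right₀ (χ.apply_ne_zero h)]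

end MulChar

theorem gaussSum_eq_sum_units {F R : Type*} [Field F] [Fintype F] [DecidableEq F]
    [CommRing R] (χ : MulChar F R) (ψ : AddChar F R) :
    gaussSum χ ψ = ∑ x : Fˣ, χ (x : F) * ψ (x : F) := by
  refine (Fintype.sum_of_injective _ Units.val_injective _ _ (fun x hx => ?_) fun _ => rfl).symm
  rw [χ.map_nonunit fun ⟨u, hu⟩ => hx ⟨u, hu⟩, zero_mul]

theorem gaussSum_inv_mul_gaussSum {F R : Type*} [Field F] [Fintype F]
    [CommRing R] [IsDomain R] {χ : MulChar F R} (hχ : χ ≠ 1) {ψ : AddChar F R}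
    (hψ : ψ.IsPrimitive) :
    gaussSum χ⁻¹ ψ * gaussSum χ ψ = χ (-1) * Fintype.card F := by
  have h1 : χ⁻¹ (-1) = χ (-1) := by
    rw [MulChar.inv_apply' χ, inv_neg, inv_one]
  rw [← gaussSum_mul_gaussSum_eq_card hχ hψ, ← mul_gaussSum_inv_eq_gaussSum χ⁻¹ ψ, h1]
  ring

/-- The pullback of a nontrivial additive character along the trace is primitive. -/
theorem AddChar.isPrimitive_comp_trace {E K R : Type*} [Field E] [Field K] [Algebra E K]
    [FiniteDimensional E K] [Algebra.IsSeparable E K] [CommMonoid R] {ψ : AddChar E R}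
    (hψ : ψ ≠ 1) :
    (ψ.compAddMonoidHom (Algebra.trace E K).toAddMonoidHom).IsPrimitive := by
  refine AddChar.IsPrimitive.of_ne_one fun h => hψ ?_
  ext y
  obtain ⟨x, rfl⟩ := LinearMap.surjective (Algebra.trace_ne_zero E K) y
  exact DFunLike.congr_fun h x


/-- Let `E ⊆ K` be finite fields of odd characteristic with
`[K:E] = k`, `σ_K` a ring automorphism of `K` mapping `E` onto itself with induced
automorphism `σ_E` (an involution compatible with norm and trace), `ψ` a nontrivial
`σ_E`-invariant additive character of `E`, `α` a multiplicative character of `K`, and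
`χ` a multiplicative character of `E` with `χ(y σ_E(y)) = 1` for all `y ∈ Eˣ`. Set
`S = ∑_{x ∈ Kˣ, x ≠ -1} α(x) χ(N(1+x)) χ(N(1 + σ_K(x)⁻¹))`. Then (1) if
`α = (χ ∘ N)⁻¹` on `Kˣ` then `S = |K| - 2`, and (2) otherwise
`S = -|K|⁻¹ (∑_x α(x)⁻¹ χ(N x)⁻¹ ψ_K(x)) (∑_x α(σ_K x) χ(N x)⁻¹ ψ_K(x))`, where
`ψ_K = ψ ∘ Tr_{K/E}`. -/
theorem split_torus_doubling_jacobi_sum_conjugate_dual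
    (E K : Type*) [Field E] [Fintype E] [DecidableEq E]
    [Field K] [Fintype K] [DecidableEq K] [Algebra E K]
    (hE : ringChar E ≠ 2) (k : ℕ) (hdeg : Module.finrank E K = k)
    (σK : K ≃+* K) (σE : E ≃+* E)
    (hσ : ∀ x : E, σK (algebraMap E K x) = algebraMap E K (σE x))
    (hinv : ∀ y : E, σE (σE y) = y)
    (hnorm : ∀ x : K, Algebra.norm E (σK x) = σE (Algebra.norm E x))
    (htrace : ∀ x : K, Algebra.trace E K (σK x) = σE (Algebra.trace E K x))
    (ψ : AddChar E ℂ) (hψ : ψ ≠ 1) (hψσ : ∀ y : E, ψ (σE y) = ψ y)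
    (α : MulChar K ℂ) (χ : MulChar E ℂ)
    (hχ : ∀ y : Eˣ, χ ((y : E) * σE (y : E)) = 1)
    (S : ℂ)
    (hS : S = ∑ x ∈ Finset.univ.filter (fun x : Kˣ => (x : K) ≠ -1),
      α (x : K) * χ (Algebra.norm E (1 + (x : K))) *
        χ (Algebra.norm E (1 + (σK (x : K))⁻¹))) :
    ((∀ x : Kˣ, α (x : K) = (χ (Algebra.norm E (x : K)))⁻¹) →
      S = (Fintype.card K : ℂ) - 2) ∧
    ((¬ ∀ x : Kˣ, α (x : K) = (χ (Algebra.norm E (x : K)))⁻¹) →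
      S = -(Fintype.card K : ℂ)⁻¹ *
        (∑ x : Kˣ, (α (x : K))⁻¹ * (χ (Algebra.norm E (x : K)))⁻¹ *
          ψ (Algebra.trace E K (x : K))) *
        (∑ x : Kˣ, α (σK (x : K)) * (χ (Algebra.norm E (x : K)))⁻¹ *
          ψ (Algebra.trace E K (x : K)))) := by
  have hXσ (x : K) : χ.compNorm K (σK x) = (χ.compNorm K x)⁻¹ := by
    rcases eq_or_ne x 0 with rfl | hx
    · simp only [map_zero, MulChar.map_zero, inv_zero]
    · have hN : Algebra.norm E x ≠ 0 := Algebra.norm_ne_zero_iff.mpr hx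
      have h := hχ (Units.mk0 _ hN)
      rw [map_mul, Units.val_mk0] at h
      rw [MulChar.compNorm_apply, MulChar.compNorm_apply, hnorm]
      exact eq_inv_of_mul_eq_one_right h
  set X : MulChar K ℂ := χ.compNorm K with hX
  set η : MulChar K ℂ := α * X with hη
  set Ψ : AddChar K ℂ := ψ.compAddMonoidHom (Algebra.trace E K).toAddMonoidHom with hΨ
  have hΨσ (x : K) : Ψ (σK x) = Ψ x :=
    (congrArg ψ (htrace x)).trans (hψσ _)
  have hSη : S = ∑ x : Kˣ, η (x : K) - η (-1) := by
    rw [hS, ← MulChar.sum_units_ne_neg_one]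
    refine Finset.sum_congr rfl fun x hx => ?_
    have hx' : (x : K) ≠ -1 := (Finset.mem_filter.mp hx).2
    have hσx : 1 + (σK (x : K))⁻¹ = σK (1 + (x : K)⁻¹) := by
      rw [map_add, map_one, map_inv₀]
    rw [hσx, ← MulChar.compNorm_apply, ← MulChar.compNorm_apply, ← hX, hXσ, mul_assoc,
      X.apply_one_add_mul_inv x.ne_zero hx', hη, MulChar.mul_apply]
  have hη1 : (∀ x : Kˣ, α (x : K) = (χ (Algebra.norm E (x : K)))⁻¹) ↔ η = 1 := by
    rw [MulChar.ext_iff]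
    refine forall_congr' fun x => ?_
    rw [MulChar.one_apply_coe, hη, MulChar.mul_apply, ← MulChar.compNorm_apply, ← hX,
      mul_eq_one_iff_eq_inv₀ (X.apply_ne_zero x.ne_zero)]
  rw [hη1]
  refine ⟨fun h => ?_, fun h => ?_⟩
  · rw [hSη, h, MulChar.one_apply isUnit_one.neg]
    simp only [MulChar.one_apply_coe, Finset.sum_const, Finset.card_univ, nsmul_eq_mul, mul_one]
    rw [Fintype.card_units, Nat.cast_sub Fintype.card_pos]
    push_cast
    ring
  · have h1 : ∑ x : Kˣ, (α (x : K))⁻¹ * (χ (Algebra.norm E (x : K)))⁻¹ *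
        ψ (Algebra.trace E K (x : K)) = gaussSum η⁻¹ Ψ := by
      rw [gaussSum_eq_sum_units]
      refine Finset.sum_congr rfl fun x _ => ?_
      rw [MulChar.inv_apply_eq_inv', hη, MulChar.mul_apply, mul_inv]
      rfl
    have h2 : ∑ x : Kˣ, α (σK (x : K)) * (χ (Algebra.norm E (x : K)))⁻¹ *
        ψ (Algebra.trace E K (x : K)) = gaussSum η Ψ := by
      rw [gaussSum_eq_sum_units]
      refine Fintype.sum_equiv (Units.mapEquiv σK.toMulEquiv).toEquiv _ _ fun x => ?_
      change _ = η (σK x) * Ψ (σK x)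
      rw [hΨσ, hη, MulChar.mul_apply, hXσ]
      rfl
    have hK : (Fintype.card K : ℂ) ≠ 0 := Nat.cast_ne_zero.mpr Fintype.card_ne_zero
    rw [h1, h2, mul_assoc,
      gaussSum_inv_mul_gaussSum h (AddChar.isPrimitive_comp_trace hψ), hSη,
      MulChar.sum_units_eq_zero_of_ne_one h]
    field_simp
    ring
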